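/- Let n ≥ 6, let U ⊂ {1, ..., n} with |U| = m, 3 ≤ m ≤ n/2, and let i, j ∈ U be distinct. Let u be the degree-1 polynomial u(x) = Σ_{ℓ∈U, ℓ≠i,j} ((n-m)/(m-2))(x_{iℓ} - x_{jℓ}) + Σ_{t∉U} (-x_{it} + x_{jt}). Then for every polynomial w of degree at most 1 on ℝ^{n(n-1)/2}, (1/|X|) Σ_{x∈X} h_U(x) u(x) w(x) = (2(m-2)/((n-3)(m-1))) ⟨u, w⟩, where ⟨·,·⟩ is the inner product making the monomial basis {1} ∪ {x_{st} : 1 ≤ s < t ≤ n} orthonormal; i.e., u is an eigenvector of the matrix of the quadratic form q_{h_U} with eigenvalue 2(m-2)/((n-3)(m-1)). -/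

import Mathlib

open Finset
noncomputable section
open scoped Classical

/-- Index type for the coordinates of `ℝ^{n(n-1)/2}`: unordered pairs of distinct
vertices of the complete graph `K_n` on `Fin n`. -/
abbrev EdgeIdx (n : ℕ) := {e : Sym2 (Fin n) // ¬ e.IsDiag}

/-- The incidence vector of the Hamiltonian cycle of `K_n` determined by a
permutation `σ` of the vertices (the cycle visiting `σ 0, σ 1, …, σ (n-1)` in order). -/
def cycleVec (n : ℕ) (σ : Equiv.Perm (Fin n)) : EdgeIdx n → ℝ :=
  fun e => if ∃ i : Fin n, (e : Sym2 (Fin n)) = s(σ i, σ (finRotate n i)) then 1 else 0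

/-- `X`, the (finite) set of incidence vectors of Hamiltonian cycles of `K_n`. -/
def hamX (n : ℕ) : Finset (EdgeIdx n → ℝ) := Finset.image (cycleVec n) Finset.univ

/-- The entry `x_{ij}` of a vector `x : EdgeIdx n → ℝ` at the unordered pair `{i,j}`
(conventionally `0` if `i = j`). -/
def xval {n : ℕ} (x : EdgeIdx n → ℝ) (i j : Fin n) : ℝ :=
  if h : i = j then 0 else x ⟨s(i, j), by simpa [Sym2.isDiag_iff_proj_eq] using h⟩

/-- The subtour elimination function `h_U(x) = c (Σ_{u∈U, v∉U} x_{uv} - 2)` with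
`c = (n-1)/(2(m(n-m)+1-n))`, where `m = |U|` (so that `h_U` has average value `1`
on `X`). -/
def hU {n : ℕ} (U : Finset (Fin n)) (x : EdgeIdx n → ℝ) : ℝ :=
  (((n : ℝ) - 1) / (2 * ((U.card : ℝ) * ((n : ℝ) - (U.card : ℝ)) + 1 - (n : ℝ)))) *
    ((∑ u ∈ U, ∑ v ∈ Uᶜ, xval x u v) - 2)

/-- Coefficient vector (in the monomial basis `{x_{pq}}`) of the degree-1 polynomial
`x_{ab} - x_{bc} + x_{cd} - x_{da}` for distinct vertices `a, b, c, d`. -/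
def quadCoef {n : ℕ} (a b c d : Fin n) : EdgeIdx n → ℝ := fun e =>
  (if (e : Sym2 (Fin n)) = s(a, b) then 1 else 0)
    - (if (e : Sym2 (Fin n)) = s(b, c) then 1 else 0)
    + (if (e : Sym2 (Fin n)) = s(c, d) then 1 else 0)
    - (if (e : Sym2 (Fin n)) = s(d, a) then 1 else 0)


/-- Coefficient vector (in the monomial basis `{x_{st}}`) of the degree-1 polynomial
`u(x) = Σ_{l∈U, l≠i,j} ((n-m)/(m-2)) (x_{il} - x_{jl}) + Σ_{t∉U} (-x_{it} + x_{jt})`. -/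
def starCoef {n : ℕ} (U : Finset (Fin n)) (m : ℕ) (i j : Fin n) : EdgeIdx n → ℝ :=
  fun e =>
    (∑ l ∈ U \ {i, j}, (((n : ℝ) - (m : ℝ)) / ((m : ℝ) - 2)) *
        ((if (e : Sym2 (Fin n)) = s(i, l) then 1 else 0)
          - (if (e : Sym2 (Fin n)) = s(j, l) then 1 else 0)))
    + ∑ t ∈ Uᶜ,
        (-(if (e : Sym2 (Fin n)) = s(i, t) then 1 else 0)
          + (if (e : Sym2 (Fin n)) = s(j, t) then 1 else 0))


section HamiltonianCycles

variable {n : ℕ}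

/-- The vector obtained from `x` by relabelling the vertices along `τ`. -/
def permuteVec (τ : Equiv.Perm (Fin n)) (x : EdgeIdx n → ℝ) : EdgeIdx n → ℝ :=
  fun e => x ⟨Sym2.map τ e, by simpa [Sym2.isDiag_map τ.injective] using e.2⟩

lemma xval_permuteVec (τ : Equiv.Perm (Fin n)) (x : EdgeIdx n → ℝ) (a b : Fin n) :
    xval (permuteVec τ x) a b = xval x (τ a) (τ b) := by
  by_cases h : a = b
  · simp [xval, h]
  · simp [xval, h, permuteVec]

lemma permuteVec_permuteVec (τ ρ : Equiv.Perm (Fin n)) (x : EdgeIdx n → ℝ) :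
    permuteVec τ (permuteVec ρ x) = permuteVec (ρ * τ) x := by
  funext e
  simp [permuteVec, Sym2.map_map]

lemma permuteVec_one (x : EdgeIdx n → ℝ) : permuteVec 1 x = x := by
  funext e
  simp [permuteVec]

lemma permuteVec_cycleVec (τ σ : Equiv.Perm (Fin n)) :
    permuteVec τ (cycleVec n σ) = cycleVec n (τ⁻¹ * σ) := by
  funext e
  obtain ⟨e, he⟩ := e
  induction e with
  | _ a b =>
    simp [permuteVec, cycleVec, Equiv.eq_symm_apply]

lemma permuteVec_mem_hamX (τ : Equiv.Perm (Fin n)) {x : EdgeIdx n → ℝ} (hx : x ∈ hamX n) :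
    permuteVec τ x ∈ hamX n := by
  obtain ⟨σ, -, rfl⟩ := Finset.mem_image.1 hx
  exact Finset.mem_image.2 ⟨τ⁻¹ * σ, Finset.mem_univ _, (permuteVec_cycleVec τ σ).symm⟩

lemma hamX_nonempty : (hamX n).Nonempty :=
  ⟨cycleVec n 1, Finset.mem_image_of_mem _ (Finset.mem_univ _)⟩

lemma xval_self (x : EdgeIdx n → ℝ) (a : Fin n) : xval x a a = 0 := by simp [xval]

lemma xval_comm (x : EdgeIdx n → ℝ) (a b : Fin n) : xval x a b = xval x b a := by
  by_cases h : a = b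
  · simp [h]
  · simp [xval, h, Ne.symm h, Sym2.eq_swap (a := a)]

lemma val_finRotate (hn : 0 < n) (p : Fin n) :
    (finRotate n p : ℕ) = if (p : ℕ) + 1 = n then 0 else (p : ℕ) + 1 := by
  obtain ⟨k, rfl⟩ := Nat.exists_eq_succ_of_ne_zero hn.ne'
  rw [coe_finRotate]
  simp [Fin.ext_iff]

lemma xval_cycleVec (hn : 2 ≤ n) (σ : Equiv.Perm (Fin n)) (p q : Fin n) :
    xval (cycleVec n σ) (σ p) (σ q) =
      if finRotate n p = q ∨ finRotate n q = p then 1 else 0 := by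
  by_cases h : p = q
  · subst h
    have hp : finRotate n p ≠ p := by
      intro hp
      have := congrArg Fin.val hp
      rw [val_finRotate (by omega)] at this
      split_ifs at this <;> omega
    simp only [xval_self, hp, or_self, if_false]
  · have h' : σ p ≠ σ q := fun H => h (σ.injective H)
    simp only [xval, h', dif_neg, not_false_eq_true, cycleVec]
    refine if_congr ⟨?_, ?_⟩ rfl rfl
    · rintro ⟨k, hk⟩
      rcases Sym2.eq_iff.1 hk with ⟨h1, h2⟩ | ⟨h1, h2⟩
      · left; rw [σ.injective h1, σ.injective h2]
      · right; rw [σ.injective h1, σ.injective h2]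
    · rintro (rfl | rfl)
      · exact ⟨p, rfl⟩
      · exact ⟨q, Sym2.eq_swap⟩

lemma xval_mul_self {x : EdgeIdx n → ℝ} (hx : x ∈ hamX n) (a b : Fin n) :
    xval x a b * xval x a b = xval x a b := by
  obtain ⟨σ, -, rfl⟩ := Finset.mem_image.1 hx
  unfold xval cycleVec
  split_ifs <;> simp

lemma sum_xval (hn : 3 ≤ n) {x : EdgeIdx n → ℝ} (hx : x ∈ hamX n) (a : Fin n) :
    ∑ b, xval x a b = 2 := by
  obtain ⟨σ, -, rfl⟩ := Finset.mem_image.1 hx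
  obtain ⟨p, rfl⟩ := σ.surjective a
  rw [← Equiv.sum_comp σ]
  have key : ∀ q : Fin n, xval (cycleVec n σ) (σ p) (σ q) =
      (if finRotate n p = q then 1 else 0) + (if (finRotate n).symm p = q then 1 else 0) := by
    intro q
    have hs : (finRotate n).symm p = q ↔ finRotate n q = p := by
      rw [Equiv.symm_apply_eq, eq_comm]
    simp only [xval_cycleVec (show 2 ≤ n by omega), hs]
    by_cases h1 : finRotate n p = q
    · have h2 : finRotate n q ≠ p := by
        intro h2
        have e1 := congrArg Fin.val h1
        have e2 := congrArg Fin.val h2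
        rw [val_finRotate (by omega)] at e1 e2
        split_ifs at e1 e2 <;> omega
      simp only [h1, h2, or_false, if_true, if_false, add_zero]
    · simp only [h1, false_or, if_false, zero_add]
  simp only [key, Finset.sum_add_distrib, Finset.sum_ite_eq, Finset.mem_univ, if_true]
  norm_num

lemma xval_triangle (hn : 4 ≤ n) {x : EdgeIdx n → ℝ} (hx : x ∈ hamX n) (a b c : Fin n) :
    xval x a b * xval x b c * xval x c a = 0 := by
  obtain ⟨σ, -, rfl⟩ := Finset.mem_image.1 hx
  obtain ⟨p, rfl⟩ := σ.surjective a
  obtain ⟨q, rfl⟩ := σ.surjective b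
  obtain ⟨r, rfl⟩ := σ.surjective c
  have hp := val_finRotate (by omega) p
  have hq := val_finRotate (by omega) q
  have hr := val_finRotate (by omega) r
  simp only [xval_cycleVec (show 2 ≤ n by omega), Fin.ext_iff]
  by_contra h
  simp only [mul_eq_zero, not_or, ite_eq_right_iff, one_ne_zero, imp_false] at h
  split_ifs at hp hq hr <;> omega

/-- The average of `f` over the Hamiltonian cycles. -/
def cycleAvg (f : (EdgeIdx n → ℝ) → ℝ) : ℝ :=
  ((hamX n).card : ℝ)⁻¹ * ∑ x ∈ hamX n, f x

lemma cycleAvg_congr {f g : (EdgeIdx n → ℝ) → ℝ} (h : ∀ x ∈ hamX n, f x = g x) :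
    cycleAvg f = cycleAvg g := by
  rw [cycleAvg, Finset.sum_congr rfl h, cycleAvg]

lemma cycleAvg_add (f g : (EdgeIdx n → ℝ) → ℝ) :
    cycleAvg (fun x => f x + g x) = cycleAvg f + cycleAvg g := by
  simp [cycleAvg, Finset.sum_add_distrib, mul_add]

lemma cycleAvg_sub (f g : (EdgeIdx n → ℝ) → ℝ) :
    cycleAvg (fun x => f x - g x) = cycleAvg f - cycleAvg g := by
  simp [cycleAvg, Finset.sum_sub_distrib, mul_sub]

lemma cycleAvg_const_mul (r : ℝ) (f : (EdgeIdx n → ℝ) → ℝ) :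
    cycleAvg (fun x => r * f x) = r * cycleAvg f := by
  simp only [cycleAvg, ← Finset.mul_sum]
  ring

lemma cycleAvg_sum {ι : Type*} (s : Finset ι) (f : ι → (EdgeIdx n → ℝ) → ℝ) :
    cycleAvg (fun x => ∑ k ∈ s, f k x) = ∑ k ∈ s, cycleAvg (f k) := by
  simp only [cycleAvg, ← Finset.mul_sum]
  rw [Finset.sum_comm]

lemma cycleAvg_one : cycleAvg (n := n) (fun _ => 1) = 1 := by
  have : ((hamX n).card : ℝ) ≠ 0 := by
    exact_mod_cast (Finset.card_pos.2 hamX_nonempty).ne'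
  simp [cycleAvg, this]

lemma cycleAvg_permuteVec (τ : Equiv.Perm (Fin n)) (f : (EdgeIdx n → ℝ) → ℝ) :
    cycleAvg (fun x => f (permuteVec τ x)) = cycleAvg f := by
  unfold cycleAvg
  congr 1
  refine Finset.sum_nbij' (permuteVec τ) (permuteVec τ⁻¹) (fun x hx => permuteVec_mem_hamX _ hx)
    (fun x hx => permuteVec_mem_hamX _ hx) ?_ ?_ (fun _ _ => rfl)
  · intro x _
    rw [permuteVec_permuteVec, mul_inv_cancel, permuteVec_one]
  · intro x _
    rw [permuteVec_permuteVec, inv_mul_cancel, permuteVec_one]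

/-- Summing the degree equation at `v` against a function `G` that only sees the vertices in `V`. -/
lemma cycleAvg_mul_xval (hn : 3 ≤ n) (V : Finset (Fin n)) (G : (EdgeIdx n → ℝ) → ℝ)
    (hG : ∀ τ : Equiv.Perm (Fin n), (∀ a ∈ V, τ a = a) → ∀ x, G (permuteVec τ x) = G x)
    {v b : Fin n} (hv : v ∈ V) (hb : b ∉ V) :
    ((n : ℝ) - V.card) * cycleAvg (fun x => G x * xval x v b) =
      2 * cycleAvg G - ∑ c ∈ V, cycleAvg (fun x => G x * xval x v c) := by
  have hconst : ∀ c ∈ Vᶜ, cycleAvg (fun x => G x * xval x v c) =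
      cycleAvg (fun x => G x * xval x v b) := by
    intro c hc
    have hc' : c ∉ V := Finset.mem_compl.1 hc
    rw [← cycleAvg_permuteVec (Equiv.swap b c)]
    have hfix : ∀ a ∈ V, Equiv.swap b c a = a := fun a ha =>
      Equiv.swap_apply_of_ne_of_ne (fun h => hb (h ▸ ha)) (fun h => hc' (h ▸ ha))
    refine cycleAvg_congr fun x _ => ?_
    rw [hG _ hfix, xval_permuteVec, hfix v hv, Equiv.swap_apply_right]
  have htotal : ∑ c, cycleAvg (fun x => G x * xval x v c) = 2 * cycleAvg G := by
    rw [← cycleAvg_sum, ← cycleAvg_const_mul]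
    refine cycleAvg_congr fun x hx => ?_
    rw [← Finset.mul_sum, sum_xval hn hx, mul_comm]
  rw [← htotal, ← Finset.sum_add_sum_compl V, add_sub_cancel_left, Finset.sum_congr rfl hconst,
    Finset.sum_const, nsmul_eq_mul, Finset.card_compl, Fintype.card_fin,
    Nat.cast_sub (by simpa using V.card_le_univ)]

lemma cycleAvg_edge (hn : 6 ≤ n) {a b : Fin n} (hab : a ≠ b) :
    cycleAvg (fun x => xval x a b) = 2 / ((n : ℝ) - 1) := by
  have hn' : (6 : ℝ) ≤ n := by exact_mod_cast hn
  have h := cycleAvg_mul_xval (by omega) {a} (fun _ => 1) (fun _ _ _ => rfl)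
    (Finset.mem_singleton_self a) (b := b) (by simpa using hab.symm)
  simp only [Finset.sum_singleton, Finset.card_singleton, xval_self, one_mul] at h
  have h0 : cycleAvg (n := n) (fun _ => 0) = 0 := by simp [cycleAvg]
  rw [cycleAvg_one, h0] at h
  rw [eq_div_iff (by linarith)]
  push_cast at h
  linarith

lemma cycleAvg_path_two (hn : 6 ≤ n) {a b c : Fin n} (hab : a ≠ b) (hac : a ≠ c) (hbc : b ≠ c) :
    cycleAvg (fun x => xval x a b * xval x b c) = 2 / (((n : ℝ) - 1) * ((n : ℝ) - 2)) := by
  have hn' : (6 : ℝ) ≤ n := by exact_mod_cast hn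
  have h := cycleAvg_mul_xval (by omega) {a, b} (fun x => xval x a b)
    (fun τ hτ x => by simp only [xval_permuteVec, hτ a (by simp), hτ b (by simp)])
    (v := b) (by simp) (b := c) (by simp [hac.symm, hbc.symm])
  have h1 : cycleAvg (fun x => xval x a b * xval x b a) = cycleAvg (fun x => xval x a b) :=
    cycleAvg_congr fun x hx => by rw [xval_comm x b a, xval_mul_self hx]
  have h2 : cycleAvg (fun x => xval x a b * xval x b b) = 0 := by simp [cycleAvg, xval_self]
  rw [Finset.sum_pair hab, Finset.card_pair hab, h1, h2, cycleAvg_edge hn hab] at h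
  have e1 : (n : ℝ) - 1 ≠ 0 := by linarith
  have e2 : (n : ℝ) - 2 ≠ 0 := by linarith
  push_cast at h
  field_simp at h ⊢
  linarith

lemma cycleAvg_two_edges (hn : 6 ≤ n) {a b c d : Fin n} (hab : a ≠ b) (hac : a ≠ c) (had : a ≠ d)
    (hbc : b ≠ c) (hbd : b ≠ d) (hcd : c ≠ d) :
    cycleAvg (fun x => xval x a b * xval x c d) = 4 / (((n : ℝ) - 1) * ((n : ℝ) - 2)) := by
  have hn' : (6 : ℝ) ≤ n := by exact_mod_cast hn
  have h := cycleAvg_mul_xval (by omega) {a, b, c} (fun x => xval x a b)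
    (fun τ hτ x => by simp only [xval_permuteVec, hτ a (by simp), hτ b (by simp)])
    (v := c) (by simp) (b := d) (by simp [had.symm, hbd.symm, hcd.symm])
  have h1 : cycleAvg (fun x => xval x a b * xval x c a) =
      cycleAvg (fun x => xval x b a * xval x a c) :=
    cycleAvg_congr fun x hx => by rw [xval_comm x c a, xval_comm x a b]
  have h2 : cycleAvg (fun x => xval x a b * xval x c b) =
      cycleAvg (fun x => xval x a b * xval x b c) :=
    cycleAvg_congr fun x hx => by rw [xval_comm x c b]
  have h3 : cycleAvg (fun x => xval x a b * xval x c c) = 0 := by simp [cycleAvg, xval_self]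
  rw [Finset.card_eq_three.2 ⟨a, b, c, hab, hac, hbc, rfl⟩,
    Finset.sum_insert (by simp [hab, hac]), Finset.sum_pair hbc, h1, h2, h3,
    cycleAvg_edge hn hab, cycleAvg_path_two hn hab.symm hbc hac,
    cycleAvg_path_two hn hab hac hbc] at h
  have e1 : (n : ℝ) - 1 ≠ 0 := by linarith
  have e2 : (n : ℝ) - 2 ≠ 0 := by linarith
  have e3 : (n : ℝ) - 3 ≠ 0 := by linarith
  push_cast at h
  rw [← mul_right_inj' e3, h]
  field_simp
  ring

lemma cycleAvg_path_three (hn : 6 ≤ n) {a b c d : Fin n} (hab : a ≠ b) (hac : a ≠ c) (had : a ≠ d)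
    (hbc : b ≠ c) (hbd : b ≠ d) (hcd : c ≠ d) :
    cycleAvg (fun x => xval x a b * xval x b c * xval x c d) =
      2 / (((n : ℝ) - 1) * ((n : ℝ) - 2) * ((n : ℝ) - 3)) := by
  have hn' : (6 : ℝ) ≤ n := by exact_mod_cast hn
  have h := cycleAvg_mul_xval (by omega) {a, b, c} (fun x => xval x a b * xval x b c)
    (fun τ hτ x => by
      simp only [xval_permuteVec, hτ a (by simp), hτ b (by simp), hτ c (by simp)])
    (v := c) (by simp) (b := d) (by simp [had.symm, hbd.symm, hcd.symm])
  have h1 : cycleAvg (fun x => xval x a b * xval x b c * xval x c a) = 0 := by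
    rw [cycleAvg_congr fun x hx => xval_triangle (by omega) hx a b c]
    simp [cycleAvg]
  have h2 : cycleAvg (fun x => xval x a b * xval x b c * xval x c b) =
      cycleAvg (fun x => xval x a b * xval x b c) :=
    cycleAvg_congr fun x hx => by rw [xval_comm x c b, mul_assoc, xval_mul_self hx]
  have h3 : cycleAvg (fun x => xval x a b * xval x b c * xval x c c) = 0 := by
    simp [cycleAvg, xval_self]
  rw [Finset.card_eq_three.2 ⟨a, b, c, hab, hac, hbc, rfl⟩,
    Finset.sum_insert (by simp [hab, hac]), Finset.sum_pair hbc, h1, h2, h3,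
    cycleAvg_path_two hn hab hac hbc] at h
  have e1 : (n : ℝ) - 1 ≠ 0 := by linarith
  have e2 : (n : ℝ) - 2 ≠ 0 := by linarith
  have e3 : (n : ℝ) - 3 ≠ 0 := by linarith
  push_cast at h
  rw [← mul_right_inj' e3, h]
  field_simp
  ring

lemma cycleAvg_claw (hn : 6 ≤ n) {a b c d : Fin n} (hab : a ≠ b) (hac : a ≠ c) (had : a ≠ d)
    (hbc : b ≠ c) (hbd : b ≠ d) (hcd : c ≠ d) :
    cycleAvg (fun x => xval x a b * xval x b c * xval x b d) = 0 := by
  have hn' : (6 : ℝ) ≤ n := by exact_mod_cast hn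
  have h := cycleAvg_mul_xval (by omega) {a, b, c} (fun x => xval x a b * xval x b c)
    (fun τ hτ x => by
      simp only [xval_permuteVec, hτ a (by simp), hτ b (by simp), hτ c (by simp)])
    (v := b) (by simp) (b := d) (by simp [had.symm, hbd.symm, hcd.symm])
  have h1 : cycleAvg (fun x => xval x a b * xval x b c * xval x b a) =
      cycleAvg (fun x => xval x a b * xval x b c) :=
    cycleAvg_congr fun x hx => by
      rw [xval_comm x b a, mul_right_comm, xval_mul_self hx]
  have h2 : cycleAvg (fun x => xval x a b * xval x b c * xval x b b) = 0 := by
    simp [cycleAvg, xval_self]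
  have h3 : cycleAvg (fun x => xval x a b * xval x b c * xval x b c) =
      cycleAvg (fun x => xval x a b * xval x b c) :=
    cycleAvg_congr fun x hx => by rw [mul_assoc, xval_mul_self hx]
  rw [Finset.card_eq_three.2 ⟨a, b, c, hab, hac, hbc, rfl⟩,
    Finset.sum_insert (by simp [hab, hac]), Finset.sum_pair hbc, h1, h2, h3] at h
  have e3 : (n : ℝ) - 3 ≠ 0 := by linarith
  push_cast at h
  rw [← mul_right_inj' e3, h]
  ring

lemma cycleAvg_path_two_edge (hn : 6 ≤ n) {a b c d e : Fin n} (hab : a ≠ b) (hac : a ≠ c)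
    (had : a ≠ d) (hae : a ≠ e) (hbc : b ≠ c) (hbd : b ≠ d) (hbe : b ≠ e) (hcd : c ≠ d)
    (hce : c ≠ e) (hde : d ≠ e) :
    cycleAvg (fun x => xval x a b * xval x b c * xval x d e) =
      4 / (((n : ℝ) - 1) * ((n : ℝ) - 2) * ((n : ℝ) - 3)) := by
  have hn' : (6 : ℝ) ≤ n := by exact_mod_cast hn
  have h := cycleAvg_mul_xval (by omega) {a, b, c, d} (fun x => xval x a b * xval x b c)
    (fun τ hτ x => by
      simp only [xval_permuteVec, hτ a (by simp), hτ b (by simp), hτ c (by simp)])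
    (v := d) (by simp) (b := e) (by simp [hae.symm, hbe.symm, hce.symm, hde.symm])
  have h1 : cycleAvg (fun x => xval x a b * xval x b c * xval x d a) =
      cycleAvg (fun x => xval x c b * xval x b a * xval x a d) :=
    cycleAvg_congr fun x hx => by
      rw [xval_comm x d a, xval_comm x a b, xval_comm x b c, mul_comm (xval x b a)]
  have h2 : cycleAvg (fun x => xval x a b * xval x b c * xval x d b) = 0 := by
    rw [← cycleAvg_claw hn hab hac had hbc hbd hcd]
    exact cycleAvg_congr fun x hx => by rw [xval_comm x d b]
  have h3 : cycleAvg (fun x => xval x a b * xval x b c * xval x d c) =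
      cycleAvg (fun x => xval x a b * xval x b c * xval x c d) :=
    cycleAvg_congr fun x hx => by rw [xval_comm x d c]
  have h4 : cycleAvg (fun x => xval x a b * xval x b c * xval x d d) = 0 := by
    simp [cycleAvg, xval_self]
  rw [Finset.card_insert_of_notMem (by simp [hab, hac, had]),
    Finset.card_eq_three.2 ⟨b, c, d, hbc, hbd, hcd, rfl⟩,
    Finset.sum_insert (by simp [hab, hac, had]), Finset.sum_insert (by simp [hbc, hbd]),
    Finset.sum_pair hcd, h1, h2, h3, h4, cycleAvg_path_two hn hab hac hbc,
    cycleAvg_path_three hn hbc.symm hac.symm hcd hab.symm hbd had,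
    cycleAvg_path_three hn hab hac had hbc hbd hcd] at h
  have e1 : (n : ℝ) - 1 ≠ 0 := by linarith
  have e2 : (n : ℝ) - 2 ≠ 0 := by linarith
  have e3 : (n : ℝ) - 3 ≠ 0 := by linarith
  have e4 : (n : ℝ) - 4 ≠ 0 := by linarith
  push_cast at h
  rw [← mul_right_inj' e4, h]
  field_simp
  ring

lemma cycleAvg_three_edges (hn : 6 ≤ n) {a b c d e f : Fin n} (hab : a ≠ b) (hac : a ≠ c)
    (had : a ≠ d) (hae : a ≠ e) (haf : a ≠ f) (hbc : b ≠ c) (hbd : b ≠ d) (hbe : b ≠ e)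
    (hbf : b ≠ f) (hcd : c ≠ d) (hce : c ≠ e) (hcf : c ≠ f) (hde : d ≠ e) (hdf : d ≠ f)
    (hef : e ≠ f) :
    cycleAvg (fun x => xval x a b * xval x c d * xval x e f) =
      8 / (((n : ℝ) - 1) * ((n : ℝ) - 2) * ((n : ℝ) - 3)) := by
  have hn' : (6 : ℝ) ≤ n := by exact_mod_cast hn
  have h := cycleAvg_mul_xval (by omega) {a, b, c, d, e} (fun x => xval x a b * xval x c d)
    (fun τ hτ x => by
      simp only [xval_permuteVec, hτ a (by simp), hτ b (by simp), hτ c (by simp), hτ d (by simp)])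
    (v := e) (by simp) (b := f) (by simp [haf.symm, hbf.symm, hcf.symm, hdf.symm, hef.symm])
  have h1 : cycleAvg (fun x => xval x a b * xval x c d * xval x e a) =
      cycleAvg (fun x => xval x e a * xval x a b * xval x c d) :=
    cycleAvg_congr fun x hx => by ring
  have h2 : cycleAvg (fun x => xval x a b * xval x c d * xval x e b) =
      cycleAvg (fun x => xval x e b * xval x b a * xval x c d) :=
    cycleAvg_congr fun x hx => by rw [xval_comm x b a]; ring
  have h3 : cycleAvg (fun x => xval x a b * xval x c d * xval x e c) =
      cycleAvg (fun x => xval x e c * xval x c d * xval x a b) :=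
    cycleAvg_congr fun x hx => by ring
  have h4 : cycleAvg (fun x => xval x a b * xval x c d * xval x e d) =
      cycleAvg (fun x => xval x e d * xval x d c * xval x a b) :=
    cycleAvg_congr fun x hx => by rw [xval_comm x d c]; ring
  have h5 : cycleAvg (fun x => xval x a b * xval x c d * xval x e e) = 0 := by
    simp [cycleAvg, xval_self]
  rw [Finset.card_insert_of_notMem (by simp [hab, hac, had, hae]),
    Finset.card_insert_of_notMem (by simp [hbc, hbd, hbe]),
    Finset.card_eq_three.2 ⟨c, d, e, hcd, hce, hde, rfl⟩,
    Finset.sum_insert (by simp [hab, hac, had, hae]), Finset.sum_insert (by simp [hbc, hbd, hbe]),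
    Finset.sum_insert (by simp [hcd, hce]), Finset.sum_pair hde, h1, h2, h3, h4, h5,
    cycleAvg_two_edges hn hab hac had hbc hbd hcd,
    cycleAvg_path_two_edge hn hae.symm hbe.symm hce.symm hde.symm hab hac had hbc hbd hcd,
    cycleAvg_path_two_edge hn hbe.symm hae.symm hce.symm hde.symm hab.symm hbc hbd hac had hcd,
    cycleAvg_path_two_edge hn hce.symm hde.symm hae.symm hbe.symm hcd hac.symm hbc.symm had.symm
      hbd.symm hab,
    cycleAvg_path_two_edge hn hde.symm hce.symm hae.symm hbe.symm hcd.symm had.symm hbd.symm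
      hac.symm hbc.symm hab] at h
  have e1 : (n : ℝ) - 1 ≠ 0 := by linarith
  have e2 : (n : ℝ) - 2 ≠ 0 := by linarith
  have e3 : (n : ℝ) - 3 ≠ 0 := by linarith
  have e5 : (n : ℝ) - 5 ≠ 0 := by linarith
  push_cast at h
  rw [← mul_right_inj' e5, h]
  field_simp
  ring

lemma sum_eq_of_forall_ne {ι : Type*} {s : Finset ι} {f : ι → ℝ} {a : ι} {p q : ℝ}
    (ha : a ∈ s) (hp : f a = p) (hq : ∀ k ∈ s, k ≠ a → f k = q) :
    ∑ k ∈ s, f k = p + ((s.card : ℝ) - 1) * q := by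
  rw [← Finset.add_sum_erase s f ha, hp, Finset.sum_congr rfl fun k hk =>
    hq k (Finset.mem_of_mem_erase hk) (Finset.ne_of_mem_erase hk), Finset.sum_const,
    nsmul_eq_mul, Finset.cast_card_erase_of_mem ha]

lemma sum_eq_of_forall_ne_ne {ι : Type*} {s : Finset ι} {f : ι → ℝ} {a b : ι} {p p' q : ℝ}
    (ha : a ∈ s) (hb : b ∈ s) (hab : a ≠ b) (hp : f a = p) (hp' : f b = p')
    (hq : ∀ k ∈ s, k ≠ a → k ≠ b → f k = q) :
    ∑ k ∈ s, f k = p + p' + ((s.card : ℝ) - 2) * q := by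
  rw [← Finset.add_sum_erase s f ha, hp,
    sum_eq_of_forall_ne (Finset.mem_erase.2 ⟨hab.symm, hb⟩) hp' fun k hk hkb =>
      hq k (Finset.mem_of_mem_erase hk) (Finset.ne_of_mem_erase hk) hkb,
    Finset.cast_card_erase_of_mem ha]
  ring

/-- The number of edges joining `a` to the complement of `U`. -/
def cutDeg (U : Finset (Fin n)) (a : Fin n) (x : EdgeIdx n → ℝ) : ℝ := ∑ v ∈ Uᶜ, xval x a v

/-- The number of edges crossing the cut determined by `U`. -/
def cutSize (U : Finset (Fin n)) (x : EdgeIdx n → ℝ) : ℝ := ∑ u ∈ U, cutDeg U u x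

lemma cycleAvg_mul_cutSize (U : Finset (Fin n)) (G : (EdgeIdx n → ℝ) → ℝ) :
    cycleAvg (fun x => G x * cutSize U x) =
      ∑ u ∈ U, ∑ v ∈ Uᶜ, cycleAvg (fun x => G x * xval x u v) := by
  simp only [cutSize, cutDeg, Finset.mul_sum, cycleAvg_sum]

lemma cycleAvg_mul_cutDeg_mul_cutDeg (U : Finset (Fin n)) (a b : Fin n)
    (F : (EdgeIdx n → ℝ) → ℝ) :
    cycleAvg (fun x => cutDeg U a x * cutDeg U b x * F x) =
      ∑ t ∈ Uᶜ, ∑ s ∈ Uᶜ, cycleAvg (fun x => xval x a t * xval x b s * F x) := by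
  simp only [cutDeg, Finset.mul_sum, Finset.sum_mul, cycleAvg_sum]
  exact Finset.sum_comm

section CutMoments

variable {U : Finset (Fin n)} {i j s t : Fin n}

lemma cycleAvg_edge_mul_cutSize (hn : 6 ≤ n) (hi : i ∈ U) (ht : t ∈ Uᶜ) :
    cycleAvg (fun x => xval x i t * cutSize U x) =
      2 / ((n : ℝ) - 1) + ((Uᶜ.card : ℝ) - 1) * (2 / (((n : ℝ) - 1) * ((n : ℝ) - 2))) +
      ((U.card : ℝ) - 1) * (2 / (((n : ℝ) - 1) * ((n : ℝ) - 2)) +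
        ((Uᶜ.card : ℝ) - 1) * (4 / (((n : ℝ) - 1) * ((n : ℝ) - 2)))) := by
  have hne : ∀ {a b : Fin n}, a ∈ U → b ∈ Uᶜ → a ≠ b := fun ha hb h =>
    Finset.mem_compl.1 hb (h ▸ ha)
  rw [cycleAvg_mul_cutSize]
  refine sum_eq_of_forall_ne hi (sum_eq_of_forall_ne ht ?_ fun v hv hvt => ?_)
    fun u hu hui => sum_eq_of_forall_ne ht ?_ fun v hv hvt => ?_
  · rw [← cycleAvg_edge hn (hne hi ht)]
    exact cycleAvg_congr fun x hx => xval_mul_self hx _ _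
  · rw [← cycleAvg_path_two hn (hne hi ht).symm hvt.symm (hne hi hv)]
    exact cycleAvg_congr fun x hx => by rw [xval_comm x i t]
  · rw [← cycleAvg_path_two hn (hne hi ht) hui.symm (hne hu ht).symm]
    exact cycleAvg_congr fun x hx => by rw [xval_comm x u t]
  · exact cycleAvg_two_edges hn (hne hi ht) hui.symm (hne hi hv) (hne hu ht).symm hvt.symm
      (hne hu hv)

lemma cycleAvg_cherry_outside_mul_cutSize (hn : 6 ≤ n) (hi : i ∈ U) (ht : t ∈ Uᶜ) (hs : s ∈ Uᶜ)
    (hst : t ≠ s) :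
    cycleAvg (fun x => xval x i t * xval x i s * cutSize U x) =
      4 / (((n : ℝ) - 1) * ((n : ℝ) - 2)) +
      ((U.card : ℝ) - 1) * (4 / (((n : ℝ) - 1) * ((n : ℝ) - 2) * ((n : ℝ) - 3)) +
        ((Uᶜ.card : ℝ) - 2) * (4 / (((n : ℝ) - 1) * ((n : ℝ) - 2) * ((n : ℝ) - 3)))) := by
  have hne : ∀ {a b : Fin n}, a ∈ U → b ∈ Uᶜ → a ≠ b := fun ha hb h =>
    Finset.mem_compl.1 hb (h ▸ ha)
  have key := sum_eq_of_forall_ne (f := fun u => ∑ v ∈ Uᶜ,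
      cycleAvg (fun x => xval x i t * xval x i s * xval x u v)) hi
    (sum_eq_of_forall_ne_ne ht hs hst (p := 2 / (((n : ℝ) - 1) * ((n : ℝ) - 2)))
      (p' := 2 / (((n : ℝ) - 1) * ((n : ℝ) - 2))) (q := 0) ?_ ?_ fun v hv hvt hvs => ?_)
    fun u hu hui => sum_eq_of_forall_ne_ne ht hs hst
      (p := 2 / (((n : ℝ) - 1) * ((n : ℝ) - 2) * ((n : ℝ) - 3)))
      (p' := 2 / (((n : ℝ) - 1) * ((n : ℝ) - 2) * ((n : ℝ) - 3)))
      (q := 4 / (((n : ℝ) - 1) * ((n : ℝ) - 2) * ((n : ℝ) - 3))) ?_ ?_ fun v hv hvt hvs => ?_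
  · rw [cycleAvg_mul_cutSize, key]
    ring
  · rw [← cycleAvg_path_two hn (hne hi ht).symm hst (hne hi hs)]
    exact cycleAvg_congr fun x hx => by
      rw [mul_right_comm, xval_mul_self hx, xval_comm x i t]
  · rw [← cycleAvg_path_two hn (hne hi ht).symm hst (hne hi hs)]
    exact cycleAvg_congr fun x hx => by
      rw [mul_assoc, xval_mul_self hx, xval_comm x i t]
  · rw [← cycleAvg_claw hn (hne hi ht).symm hst hvt.symm (hne hi hs) (hne hi hv) hvs.symm]
    exact cycleAvg_congr fun x hx => by rw [xval_comm x i t]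
  · rw [← cycleAvg_path_three hn (hne hi hs).symm hst.symm (hne hu hs).symm (hne hi ht) hui.symm
      (hne hu ht).symm]
    exact cycleAvg_congr fun x hx => by
      rw [xval_comm x u t, xval_comm x s i, mul_comm (xval x i t)]
  · rw [← cycleAvg_path_three hn (hne hi ht).symm hst (hne hu ht).symm (hne hi hs) hui.symm
      (hne hu hs).symm]
    exact cycleAvg_congr fun x hx => by rw [xval_comm x u s, xval_comm x t i]
  · rw [← cycleAvg_path_two_edge hn (hne hi ht).symm hst (hne hu ht).symm hvt.symm (hne hi hs)
      hui.symm (hne hi hv) (hne hu hs).symm hvs.symm (hne hu hv)]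
    exact cycleAvg_congr fun x hx => by rw [xval_comm x t i]

lemma cycleAvg_two_crossing_mul_cutSize (hn : 6 ≤ n) (hi : i ∈ U) (hj : j ∈ U) (hij : i ≠ j)
    (ht : t ∈ Uᶜ) (hs : s ∈ Uᶜ) (hst : t ≠ s) :
    cycleAvg (fun x => xval x i t * xval x j s * cutSize U x) =
      2 * (4 / (((n : ℝ) - 1) * ((n : ℝ) - 2)) +
        2 / (((n : ℝ) - 1) * ((n : ℝ) - 2) * ((n : ℝ) - 3)) +
        ((Uᶜ.card : ℝ) - 2) * (4 / (((n : ℝ) - 1) * ((n : ℝ) - 2) * ((n : ℝ) - 3)))) +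
      ((U.card : ℝ) - 2) * (8 / (((n : ℝ) - 1) * ((n : ℝ) - 2) * ((n : ℝ) - 3)) +
        ((Uᶜ.card : ℝ) - 2) * (8 / (((n : ℝ) - 1) * ((n : ℝ) - 2) * ((n : ℝ) - 3)))) := by
  have hne : ∀ {a b : Fin n}, a ∈ U → b ∈ Uᶜ → a ≠ b := fun ha hb h =>
    Finset.mem_compl.1 hb (h ▸ ha)
  have key := sum_eq_of_forall_ne_ne (f := fun u => ∑ v ∈ Uᶜ,
      cycleAvg (fun x => xval x i t * xval x j s * xval x u v)) hi hj hij
    (sum_eq_of_forall_ne_ne ht hs hst (p := 4 / (((n : ℝ) - 1) * ((n : ℝ) - 2)))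
      (p' := 2 / (((n : ℝ) - 1) * ((n : ℝ) - 2) * ((n : ℝ) - 3)))
      (q := 4 / (((n : ℝ) - 1) * ((n : ℝ) - 2) * ((n : ℝ) - 3))) ?_ ?_ fun v hv hvt hvs => ?_)
    (sum_eq_of_forall_ne_ne ht hs hst
      (p := 2 / (((n : ℝ) - 1) * ((n : ℝ) - 2) * ((n : ℝ) - 3)))
      (p' := 4 / (((n : ℝ) - 1) * ((n : ℝ) - 2)))
      (q := 4 / (((n : ℝ) - 1) * ((n : ℝ) - 2) * ((n : ℝ) - 3))) ?_ ?_ fun v hv hvt hvs => ?_)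
    fun u hu hui huj => sum_eq_of_forall_ne_ne ht hs hst
      (p := 4 / (((n : ℝ) - 1) * ((n : ℝ) - 2) * ((n : ℝ) - 3)))
      (p' := 4 / (((n : ℝ) - 1) * ((n : ℝ) - 2) * ((n : ℝ) - 3)))
      (q := 8 / (((n : ℝ) - 1) * ((n : ℝ) - 2) * ((n : ℝ) - 3))) ?_ ?_ fun v hv hvt hvs => ?_
  · rw [cycleAvg_mul_cutSize, key]
    ring
  · rw [← cycleAvg_two_edges hn (hne hi ht) hij (hne hi hs) (hne hj ht).symm hst (hne hj hs)]
    exact cycleAvg_congr fun x hx => by rw [mul_right_comm, xval_mul_self hx]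
  · rw [← cycleAvg_path_three hn (hne hi ht).symm hst (hne hj ht).symm (hne hi hs) hij
      (hne hj hs).symm]
    exact cycleAvg_congr fun x hx => by rw [xval_comm x t i, xval_comm x s j]; ring
  · rw [← cycleAvg_path_two_edge hn (hne hi ht).symm hvt.symm (hne hj ht).symm hst (hne hi hv)
      hij (hne hi hs) (hne hj hv).symm hvs (hne hj hs)]
    exact cycleAvg_congr fun x hx => by rw [xval_comm x t i]; ring
  · rw [← cycleAvg_path_three hn (hne hi ht) hij (hne hi hs) (hne hj ht).symm hst (hne hj hs)]
    exact cycleAvg_congr fun x hx => by rw [xval_comm x t j]; ring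
  · rw [← cycleAvg_two_edges hn (hne hi ht) hij (hne hi hs) (hne hj ht).symm hst (hne hj hs)]
    exact cycleAvg_congr fun x hx => by rw [mul_assoc, xval_mul_self hx]
  · rw [← cycleAvg_path_two_edge hn (hne hj hs).symm hvs.symm (hne hi hs).symm hst.symm (hne hj hv)
      hij.symm (hne hj ht) (hne hi hv).symm hvt (hne hi ht)]
    exact cycleAvg_congr fun x hx => by rw [xval_comm x s j]; ring
  · rw [← cycleAvg_path_two_edge hn (hne hi ht) hui.symm hij (hne hi hs) (hne hu ht).symm
      (hne hj ht).symm hst huj (hne hu hs) (hne hj hs)]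
    exact cycleAvg_congr fun x hx => by rw [xval_comm x t u]; ring
  · rw [← cycleAvg_path_two_edge hn (hne hj hs) huj.symm hij.symm (hne hj ht) (hne hu hs).symm
      (hne hi hs).symm hst.symm hui (hne hu ht) (hne hi ht)]
    exact cycleAvg_congr fun x hx => by rw [xval_comm x s u]; ring
  · exact cycleAvg_three_edges hn (hne hi ht) hij (hne hi hs) hui.symm (hne hi hv)
      (hne hj ht).symm hst (hne hu ht).symm hvt.symm (hne hj hs) huj.symm (hne hj hv)
      (hne hu hs).symm hvs.symm (hne hu hv)

lemma cycleAvg_cherry_inside_mul_cutSize (hn : 6 ≤ n) (hi : i ∈ U) (hj : j ∈ U) (hij : i ≠ j)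
    (ht : t ∈ Uᶜ) :
    cycleAvg (fun x => xval x i t * xval x j t * cutSize U x) =
      2 * (2 / (((n : ℝ) - 1) * ((n : ℝ) - 2)) +
        ((Uᶜ.card : ℝ) - 1) * (2 / (((n : ℝ) - 1) * ((n : ℝ) - 2) * ((n : ℝ) - 3)))) +
      ((U.card : ℝ) - 2) *
        (((Uᶜ.card : ℝ) - 1) * (4 / (((n : ℝ) - 1) * ((n : ℝ) - 2) * ((n : ℝ) - 3)))) := by
  have hne : ∀ {a b : Fin n}, a ∈ U → b ∈ Uᶜ → a ≠ b := fun ha hb h =>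
    Finset.mem_compl.1 hb (h ▸ ha)
  have key := sum_eq_of_forall_ne_ne (f := fun u => ∑ v ∈ Uᶜ,
      cycleAvg (fun x => xval x i t * xval x j t * xval x u v)) hi hj hij
    (sum_eq_of_forall_ne ht (p := 2 / (((n : ℝ) - 1) * ((n : ℝ) - 2)))
      (q := 2 / (((n : ℝ) - 1) * ((n : ℝ) - 2) * ((n : ℝ) - 3))) ?_ fun v hv hvt => ?_)
    (sum_eq_of_forall_ne ht (p := 2 / (((n : ℝ) - 1) * ((n : ℝ) - 2)))
      (q := 2 / (((n : ℝ) - 1) * ((n : ℝ) - 2) * ((n : ℝ) - 3))) ?_ fun v hv hvt => ?_)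
    fun u hu hui huj => sum_eq_of_forall_ne ht (p := 0)
      (q := 4 / (((n : ℝ) - 1) * ((n : ℝ) - 2) * ((n : ℝ) - 3))) ?_ fun v hv hvt => ?_
  · rw [cycleAvg_mul_cutSize, key]
    ring
  · rw [← cycleAvg_path_two hn (hne hi ht) hij (hne hj ht).symm]
    exact cycleAvg_congr fun x hx => by
      rw [mul_right_comm, xval_mul_self hx, xval_comm x j t]
  · rw [← cycleAvg_path_three hn (hne hj ht) hij.symm (hne hj hv) (hne hi ht).symm hvt.symm
      (hne hi hv)]
    exact cycleAvg_congr fun x hx => by rw [xval_comm x t i]; ring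
  · rw [← cycleAvg_path_two hn (hne hi ht) hij (hne hj ht).symm]
    exact cycleAvg_congr fun x hx => by
      rw [mul_assoc, xval_mul_self hx, xval_comm x j t]
  · rw [← cycleAvg_path_three hn (hne hi ht) hij (hne hi hv) (hne hj ht).symm hvt.symm
      (hne hj hv)]
    exact cycleAvg_congr fun x hx => by rw [xval_comm x t j]
  · rw [← cycleAvg_claw hn (hne hi ht) hij hui.symm (hne hj ht).symm (hne hu ht).symm huj.symm]
    exact cycleAvg_congr fun x hx => by rw [xval_comm x t j, xval_comm x t u]
  · rw [← cycleAvg_path_two_edge hn (hne hi ht) hij hui.symm (hne hi hv) (hne hj ht).symm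
      (hne hu ht).symm hvt.symm huj.symm (hne hj hv) (hne hu hv)]
    exact cycleAvg_congr fun x hx => by rw [xval_comm x t j]

lemma cycleAvg_cutSize_mul_cutDeg_sub (hn : 6 ≤ n) (hi : i ∈ U) (hj : j ∈ U) (hij : i ≠ j) :
    cycleAvg (fun x => (cutSize U x - 2) * (cutDeg U i x - cutDeg U j x) * cutDeg U i x) =
      4 * ((U.card : ℝ) - 2) ^ 2 * ((n : ℝ) - U.card) * ((n : ℝ) - U.card - 1) /
        (((n : ℝ) - 1) * ((n : ℝ) - 2) * ((n : ℝ) - 3)) := by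
  have hn' : (6 : ℝ) ≤ n := by exact_mod_cast hn
  have hcard : (Uᶜ.card : ℝ) = n - U.card := by
    rw [Finset.card_compl, Fintype.card_fin, Nat.cast_sub (by simpa using U.card_le_univ)]
  have hne : ∀ {a b : Fin n}, a ∈ U → b ∈ Uᶜ → a ≠ b := fun ha hb h =>
    Finset.mem_compl.1 hb (h ▸ ha)
  have expand : cycleAvg (fun x =>
        (cutSize U x - 2) * (cutDeg U i x - cutDeg U j x) * cutDeg U i x) =
      cycleAvg (fun x => cutDeg U i x * cutDeg U i x * cutSize U x)
      - cycleAvg (fun x => cutDeg U i x * cutDeg U j x * cutSize U x)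
      - 2 * (cycleAvg (fun x => cutDeg U i x * cutDeg U i x * 1)
      - cycleAvg (fun x => cutDeg U i x * cutDeg U j x * 1)) := by
    rw [← cycleAvg_sub, ← cycleAvg_sub, ← cycleAvg_const_mul, ← cycleAvg_sub]
    exact cycleAvg_congr fun x _ => by ring
  have hii := fun t (ht : t ∈ Uᶜ) => sum_eq_of_forall_ne
    (f := fun s => cycleAvg fun x => xval x i t * xval x i s * cutSize U x) ht
    (Eq.trans (cycleAvg_congr fun x hx => by rw [xval_mul_self hx])
      (cycleAvg_edge_mul_cutSize hn hi ht))
    fun s hs hst => cycleAvg_cherry_outside_mul_cutSize hn hi ht hs hst.symm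
  have hij' := fun t (ht : t ∈ Uᶜ) => sum_eq_of_forall_ne
    (f := fun s => cycleAvg fun x => xval x i t * xval x j s * cutSize U x) ht
    (cycleAvg_cherry_inside_mul_cutSize hn hi hj hij ht)
    fun s hs hst => cycleAvg_two_crossing_mul_cutSize hn hi hj hij ht hs hst.symm
  have hii1 := fun t (ht : t ∈ Uᶜ) => sum_eq_of_forall_ne
    (f := fun s => cycleAvg fun x => xval x i t * xval x i s * 1) ht
    (Eq.trans (cycleAvg_congr fun x hx => by rw [xval_mul_self hx, mul_one])
      (cycleAvg_edge hn (hne hi ht)))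
    fun s hs hst => Eq.trans (cycleAvg_congr fun x hx => by rw [mul_one, xval_comm x i t])
      (cycleAvg_path_two hn (hne hi ht).symm hst.symm (hne hi hs))
  have hij1 := fun t (ht : t ∈ Uᶜ) => sum_eq_of_forall_ne
    (f := fun s => cycleAvg fun x => xval x i t * xval x j s * 1) ht
    (Eq.trans (cycleAvg_congr fun x hx => by rw [mul_one, xval_comm x j t])
      (cycleAvg_path_two hn (hne hi ht) hij (hne hj ht).symm))
    fun s hs hst => Eq.trans (cycleAvg_congr fun x hx => by rw [mul_one])
      (cycleAvg_two_edges hn (hne hi ht) hij (hne hi hs) (hne hj ht).symm hst.symm (hne hj hs))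
  rw [expand]
  simp only [cycleAvg_mul_cutDeg_mul_cutDeg]
  rw [Finset.sum_congr rfl hii, Finset.sum_congr rfl hij',
    Finset.sum_congr rfl hii1, Finset.sum_congr rfl hij1]
  simp only [Finset.sum_const, nsmul_eq_mul, hcard]
  have e1 : (n : ℝ) - 1 ≠ 0 := by linarith
  have e2 : (n : ℝ) - 2 ≠ 0 := by linarith
  have e3 : (n : ℝ) - 3 ≠ 0 := by linarith
  field_simp
  ring

end CutMoments

lemma cutDeg_permuteVec {U : Finset (Fin n)} {τ : Equiv.Perm (Fin n)} (hτ : ∀ v, τ v ∈ U ↔ v ∈ U)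
    (a : Fin n) (x : EdgeIdx n → ℝ) : cutDeg U a (permuteVec τ x) = cutDeg U (τ a) x := by
  simp only [cutDeg, xval_permuteVec]
  exact Finset.sum_equiv τ (fun v => by simp [hτ]) (fun _ _ => rfl)

lemma cutSize_permuteVec {U : Finset (Fin n)} {τ : Equiv.Perm (Fin n)} (hτ : ∀ v, τ v ∈ U ↔ v ∈ U)
    (x : EdgeIdx n → ℝ) : cutSize U (permuteVec τ x) = cutSize U x := by
  simp only [cutSize, cutDeg_permuteVec hτ]
  exact Finset.sum_equiv τ (fun v => by simp [hτ]) (fun _ _ => rfl)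

lemma swap_mem_iff {U : Finset (Fin n)} {a b : Fin n} (hab : a ∈ U ↔ b ∈ U) (v : Fin n) :
    Equiv.swap a b v ∈ U ↔ v ∈ U := by
  rw [Equiv.swap_apply_def]
  split_ifs with h1 h2
  · rw [h1, hab]
  · rw [h2, hab]
  · rfl

/-- The shifted cut size times the difference of the cut degrees of `i` and `j`. -/
def cutDiff (U : Finset (Fin n)) (i j : Fin n) (x : EdgeIdx n → ℝ) : ℝ :=
  (cutSize U x - 2) * (cutDeg U i x - cutDeg U j x)

lemma cutDiff_permuteVec_swap {U : Finset (Fin n)} {i j : Fin n} (hi : i ∈ U) (hj : j ∈ U)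
    (x : EdgeIdx n → ℝ) : cutDiff U i j (permuteVec (Equiv.swap i j) x) = -cutDiff U i j x := by
  have h := swap_mem_iff (U := U) (a := i) (b := j) (by simp [hi, hj])
  simp only [cutDiff, cutSize_permuteVec h, cutDeg_permuteVec h, Equiv.swap_apply_left,
    Equiv.swap_apply_right]
  ring

lemma cycleAvg_cutDiff_mul_swap {U : Finset (Fin n)} {i j : Fin n} (hi : i ∈ U) (hj : j ∈ U)
    (G : (EdgeIdx n → ℝ) → ℝ) :
    cycleAvg (fun x => cutDiff U i j x * G (permuteVec (Equiv.swap i j) x)) =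
      -cycleAvg (fun x => cutDiff U i j x * G x) := by
  rw [← cycleAvg_permuteVec (Equiv.swap i j) (fun x => cutDiff U i j x * G x), ← neg_one_mul,
    ← cycleAvg_const_mul]
  exact cycleAvg_congr fun x _ => by rw [cutDiff_permuteVec_swap hi hj]; ring

lemma cycleAvg_cutDiff_mul_eq_zero {U : Finset (Fin n)} {i j : Fin n} (hi : i ∈ U) (hj : j ∈ U)
    {G : (EdgeIdx n → ℝ) → ℝ} (hG : ∀ x, G (permuteVec (Equiv.swap i j) x) = G x) :
    cycleAvg (fun x => cutDiff U i j x * G x) = 0 := by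
  have h := cycleAvg_cutDiff_mul_swap hi hj G
  simp only [hG] at h
  linarith

lemma cycleAvg_cutDiff_mul_xval_congr {U : Finset (Fin n)} {i j a b : Fin n}
    (hab : a ∈ U ↔ b ∈ U) (hia : i ≠ a) (hib : i ≠ b) (hja : j ≠ a) (hjb : j ≠ b) :
    cycleAvg (fun x => cutDiff U i j x * xval x i a) =
      cycleAvg (fun x => cutDiff U i j x * xval x i b) := by
  rw [← cycleAvg_permuteVec (Equiv.swap a b) (fun x => cutDiff U i j x * xval x i a)]
  have h := swap_mem_iff hab
  simp only [cutDiff, cutSize_permuteVec h, cutDeg_permuteVec h, xval_permuteVec, Equiv.swap_apply_left,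
    Equiv.swap_apply_of_ne_of_ne hia hib, Equiv.swap_apply_of_ne_of_ne hja hjb]

lemma sum_univ_eq_sum_sdiff_pair {U : Finset (Fin n)} {i j : Fin n} (hi : i ∈ U) (hj : j ∈ U)
    (hij : i ≠ j) (f : Fin n → ℝ) :
    ∑ b, f b = ∑ l ∈ U \ {i, j}, f l + (f i + f j) + ∑ t ∈ Uᶜ, f t := by
  rw [← Finset.sum_add_sum_compl U, ← Finset.sum_pair hij,
    Finset.sum_sdiff (by simp [Finset.insert_subset_iff, hi, hj])]

lemma card_sdiff_pair {U : Finset (Fin n)} {i j : Fin n} (hi : i ∈ U) (hj : j ∈ U)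
    (hij : i ≠ j) : ((U \ {i, j}).card : ℝ) = U.card - 2 := by
  rw [Finset.cast_card_sdiff (by simp [Finset.insert_subset_iff, hi, hj]), Finset.card_pair hij]
  simp

lemma cycleAvg_cutDiff_mul_outside {U : Finset (Fin n)} {i j t : Fin n} (hi : i ∈ U) (hj : j ∈ U)
    (ht : t ∉ U) :
    ((n : ℝ) - U.card) * cycleAvg (fun x => cutDiff U i j x * xval x i t) =
      cycleAvg (fun x => cutDiff U i j x * cutDeg U i x) := by
  have hcard : (Uᶜ.card : ℝ) = n - U.card := by
    rw [Finset.card_compl, Fintype.card_fin, Nat.cast_sub (by simpa using U.card_le_univ)]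
  have hne : ∀ {a b : Fin n}, a ∈ U → b ∉ U → a ≠ b := fun ha hb h => hb (h ▸ ha)
  simp only [cutDeg, Finset.mul_sum, cycleAvg_sum]
  rw [Finset.sum_congr rfl fun v hv => cycleAvg_cutDiff_mul_xval_congr (b := t)
    (by simp [ht, Finset.mem_compl.1 hv]) (hne hi (Finset.mem_compl.1 hv)) (hne hi ht)
    (hne hj (Finset.mem_compl.1 hv)) (hne hj ht), Finset.sum_const, nsmul_eq_mul, hcard]

lemma cycleAvg_cutDiff_mul_inside (hn : 3 ≤ n) {U : Finset (Fin n)} {i j l : Fin n} (hi : i ∈ U)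
    (hj : j ∈ U) (hij : i ≠ j) (hl : l ∈ U) (hli : l ≠ i) (hlj : l ≠ j) :
    ((U.card : ℝ) - 2) * cycleAvg (fun x => cutDiff U i j x * xval x i l) =
      -cycleAvg (fun x => cutDiff U i j x * cutDeg U i x) := by
  have hsum : ∑ k ∈ U \ {i, j}, cycleAvg (fun x => cutDiff U i j x * xval x i k) =
      ((U.card : ℝ) - 2) * cycleAvg (fun x => cutDiff U i j x * xval x i l) := by
    rw [← card_sdiff_pair hi hj hij, ← nsmul_eq_mul, ← Finset.sum_const]
    refine Finset.sum_congr rfl fun k hk => ?_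
    simp only [Finset.mem_sdiff, Finset.mem_insert, Finset.mem_singleton, not_or] at hk
    exact cycleAvg_cutDiff_mul_xval_congr (by simp [hk.1, hl]) (Ne.symm hk.2.1) hli.symm
      (Ne.symm hk.2.2) hlj.symm
  have hzero : cycleAvg (fun x => cutDiff U i j x * (2 - xval x i j)) = 0 :=
    cycleAvg_cutDiff_mul_eq_zero hi hj fun x => by
      rw [xval_permuteVec, Equiv.swap_apply_left, Equiv.swap_apply_right, xval_comm]
  rw [← hsum, ← cycleAvg_sum, ← zero_sub, ← hzero, ← cycleAvg_sub]
  refine cycleAvg_congr fun x hx => ?_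
  have hdeg := sum_xval hn hx i
  rw [sum_univ_eq_sum_sdiff_pair hi hj hij, xval_self, ← cutDeg] at hdeg
  rw [← Finset.mul_sum, ← mul_sub]
  congr 1
  linarith

lemma sum_edge_ite (y : EdgeIdx n → ℝ) {a b : Fin n} (hab : a ≠ b) :
    ∑ e : EdgeIdx n, (if (e : Sym2 (Fin n)) = s(a, b) then 1 else 0) * y e = xval y a b := by
  rw [Finset.sum_eq_single ⟨s(a, b), by simpa using hab⟩]
  · simp [xval, hab]
  · intro e _ he
    rw [if_neg fun h => he (Subtype.ext h), zero_mul]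
  · simp

lemma sum_starCoef_mul (hn : 3 ≤ n) {U : Finset (Fin n)} (hU : 3 ≤ U.card) {i j : Fin n}
    (hi : i ∈ U) (hj : j ∈ U) (hij : i ≠ j) {x : EdgeIdx n → ℝ} (hx : x ∈ hamX n) :
    ∑ e : EdgeIdx n, starCoef U U.card i j e * x e =
      -(((n : ℝ) - 2) / ((U.card : ℝ) - 2)) * (cutDeg U i x - cutDeg U j x) := by
  have hne : ∀ {a b : Fin n}, a ∈ U → b ∈ Uᶜ → a ≠ b := fun ha hb h =>
    Finset.mem_compl.1 hb (h ▸ ha)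
  have hm : (U.card : ℝ) - 2 ≠ 0 := by
    have : (3 : ℝ) ≤ U.card := by exact_mod_cast hU
    linarith
  have hsum : ∑ e : EdgeIdx n, starCoef U U.card i j e * x e =
      (((n : ℝ) - U.card) / ((U.card : ℝ) - 2)) *
        (∑ l ∈ U \ {i, j}, xval x i l - ∑ l ∈ U \ {i, j}, xval x j l)
      + -(cutDeg U i x - cutDeg U j x) := by
    simp only [starCoef, neg_add_eq_sub, add_mul, Finset.sum_add_distrib, Finset.sum_mul]
    rw [Finset.sum_comm, Finset.sum_comm (s := Finset.univ) (t := Uᶜ), cutDeg, cutDeg,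
      ← Finset.sum_sub_distrib, ← Finset.sum_sub_distrib, Finset.mul_sum,
      ← Finset.sum_neg_distrib]
    congr 1
    · refine Finset.sum_congr rfl fun l hl => ?_
      simp only [Finset.mem_sdiff, Finset.mem_insert, Finset.mem_singleton, not_or] at hl
      rw [← sum_edge_ite x (Ne.symm hl.2.1), ← sum_edge_ite x (Ne.symm hl.2.2),
        ← Finset.sum_sub_distrib, Finset.mul_sum]
      exact Finset.sum_congr rfl fun e _ => by ring
    · refine Finset.sum_congr rfl fun t ht => ?_
      rw [← sum_edge_ite x (hne hi ht), ← sum_edge_ite x (hne hj ht), ← Finset.sum_sub_distrib,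
        ← Finset.sum_neg_distrib]
      exact Finset.sum_congr rfl fun e _ => by ring
  have hdi := sum_xval hn hx i
  have hdj := sum_xval hn hx j
  rw [sum_univ_eq_sum_sdiff_pair hi hj hij, xval_self, ← cutDeg] at hdi hdj
  rw [xval_comm x j i] at hdj
  rw [hsum, show ∑ l ∈ U \ {i, j}, xval x i l - ∑ l ∈ U \ {i, j}, xval x j l =
    -(cutDeg U i x - cutDeg U j x) by linarith]
  field_simp
  ring

lemma starCoef_swap (U : Finset (Fin n)) (m : ℕ) (i j : Fin n) (e : EdgeIdx n) :
    starCoef U m j i e = -starCoef U m i j e := by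
  rw [starCoef, starCoef, neg_add, ← Finset.sum_neg_distrib, ← Finset.sum_neg_distrib,
    Finset.pair_comm]
  congr 1 <;> exact Finset.sum_congr rfl fun _ _ => by ring

lemma starCoef_left {U : Finset (Fin n)} (m : ℕ) {i j b : Fin n} (hij : i ≠ j)
    (hbj : b ≠ j) (h : ¬ (s(i, b) : Sym2 (Fin n)).IsDiag) :
    starCoef U m i j ⟨s(i, b), h⟩ =
      if b ∈ U then ((n : ℝ) - m) / ((m : ℝ) - 2) else -1 := by
  have hib : i ≠ b := by simpa using h
  by_cases hb : b ∈ U <;> simp [starCoef, hij, hbj, hb, hib.symm]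

lemma starCoef_pair (U : Finset (Fin n)) (m : ℕ) {i j : Fin n} (hi : i ∈ U) (hj : j ∈ U)
    (h : ¬ (s(i, j) : Sym2 (Fin n)).IsDiag) :
    starCoef U m i j ⟨s(i, j), h⟩ = 0 := by
  have hij : i ≠ j := by simpa using h
  rw [starCoef, Finset.sum_eq_zero, Finset.sum_eq_zero, add_zero]
  · intro t ht
    have hti : i ≠ t := fun H => Finset.mem_compl.1 ht (H ▸ hi)
    have htj : j ≠ t := fun H => Finset.mem_compl.1 ht (H ▸ hj)
    simp [hij, hti, htj]
  · intro l hl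
    simp only [Finset.mem_sdiff, Finset.mem_insert, Finset.mem_singleton, not_or] at hl
    simp [hij, Ne.symm hl.2.1, Ne.symm hl.2.2]

lemma starCoef_of_notMem (U : Finset (Fin n)) (m : ℕ) {i j : Fin n} {e : EdgeIdx n}
    (hi : i ∉ (e : Sym2 (Fin n))) (hj : j ∉ (e : Sym2 (Fin n))) :
    starCoef U m i j e = 0 := by
  have h : ∀ {a : Fin n}, a ∉ (e : Sym2 (Fin n)) → ∀ b, (e : Sym2 (Fin n)) ≠ s(a, b) :=
    fun ha b h => ha (h ▸ Sym2.mem_mk_left _ b)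
  simp [starCoef, h hi, h hj]

lemma xval_mk (x : EdgeIdx n → ℝ) {a b : Fin n} (h : ¬ (s(a, b) : Sym2 (Fin n)).IsDiag) :
    x ⟨s(a, b), h⟩ = xval x a b := by
  have hab : a ≠ b := by simpa using h
  simp [xval, hab]

lemma cycleAvg_cutDiff_mul_edge (hn : 6 ≤ n) {U : Finset (Fin n)} (hU : 3 ≤ U.card)
    (hUn : 2 * U.card ≤ n) {i j : Fin n} (hi : i ∈ U) (hj : j ∈ U) (hij : i ≠ j)
    (e : EdgeIdx n) :
    cycleAvg (fun x => cutDiff U i j x * x e) =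
      -(4 * ((U.card : ℝ) - 2) ^ 2 * ((n : ℝ) - U.card - 1) /
        (((n : ℝ) - 1) * ((n : ℝ) - 2) * ((n : ℝ) - 3))) * starCoef U U.card i j e := by
  have hn' : (6 : ℝ) ≤ n := by exact_mod_cast hn
  have hm' : (3 : ℝ) ≤ U.card := by exact_mod_cast hU
  have hmn' : 2 * (U.card : ℝ) ≤ n := by exact_mod_cast hUn
  have e1 : (n : ℝ) - 1 ≠ 0 := by linarith
  have e2 : (n : ℝ) - 2 ≠ 0 := by linarith
  have e3 : (n : ℝ) - 3 ≠ 0 := by linarith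
  have em : (U.card : ℝ) - 2 ≠ 0 := by linarith
  have enm : (n : ℝ) - U.card ≠ 0 := by linarith
  have left : ∀ b (h : ¬ (s(i, b) : Sym2 (Fin n)).IsDiag), b ≠ j →
      cycleAvg (fun x => cutDiff U i j x * xval x i b) =
      -(4 * ((U.card : ℝ) - 2) ^ 2 * ((n : ℝ) - U.card - 1) /
        (((n : ℝ) - 1) * ((n : ℝ) - 2) * ((n : ℝ) - 3))) *
        starCoef U U.card i j ⟨s(i, b), h⟩ := by
    intro b h hbj
    have hib : i ≠ b := by simpa using h
    have hK := cycleAvg_cutSize_mul_cutDeg_sub hn hi hj hij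
    rw [starCoef_left U.card hij hbj]
    by_cases hb : b ∈ U
    · have hb' := cycleAvg_cutDiff_mul_inside (by omega) hi hj hij hb hib.symm hbj
      rw [if_pos hb, ← mul_right_inj' em, hb']
      simp only [cutDiff]
      rw [hK]
      field_simp
    · have hb' := cycleAvg_cutDiff_mul_outside hi hj hb
      rw [if_neg hb, ← mul_right_inj' enm, hb']
      simp only [cutDiff]
      rw [hK]
      field_simp
  have right : ∀ b (h : ¬ (s(j, b) : Sym2 (Fin n)).IsDiag), b ≠ i →
      cycleAvg (fun x => cutDiff U i j x * xval x j b) =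
      -(4 * ((U.card : ℝ) - 2) ^ 2 * ((n : ℝ) - U.card - 1) /
        (((n : ℝ) - 1) * ((n : ℝ) - 2) * ((n : ℝ) - 3))) *
        starCoef U U.card i j ⟨s(j, b), h⟩ := by
    intro b h hbi
    have hjb : j ≠ b := by simpa using h
    have hs := cycleAvg_cutDiff_mul_swap hi hj (fun x => xval x i b)
    simp only [xval_permuteVec, Equiv.swap_apply_left,
      Equiv.swap_apply_of_ne_of_ne hbi hjb.symm] at hs
    rw [hs, left b (by simpa using hbi.symm) hjb.symm, starCoef_left _ hij hjb.symm,
      starCoef_swap, starCoef_left _ hij.symm hbi]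
    ring
  obtain ⟨e, he⟩ := e
  by_cases hie : i ∈ e
  · obtain ⟨b, rfl⟩ := hie
    by_cases hbj : b = j
    · subst hbj
      rw [starCoef_pair U _ hi hj, mul_zero]
      exact cycleAvg_cutDiff_mul_eq_zero hi hj fun x => by
        rw [xval_mk (permuteVec _ x), xval_permuteVec, Equiv.swap_apply_left, Equiv.swap_apply_right,
          xval_comm, xval_mk x]
    · rw [← left b he hbj]
      exact cycleAvg_congr fun x _ => by rw [xval_mk x]
  · by_cases hje : j ∈ e
    · obtain ⟨b, rfl⟩ := hje
      have hbi : b ≠ i := fun h => hie (by simp [h])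
      rw [← right b he hbi]
      exact cycleAvg_congr fun x _ => by rw [xval_mk x]
    · rw [starCoef_of_notMem U _ hie hje, mul_zero]
      refine cycleAvg_cutDiff_mul_eq_zero hi hj fun x => ?_
      induction e with
      | _ a b =>
        simp only [Sym2.mem_iff, not_or] at hie hje
        rw [xval_mk (permuteVec _ x), xval_mk x, xval_permuteVec,
          Equiv.swap_apply_of_ne_of_ne (Ne.symm hie.1) (Ne.symm hje.1),
          Equiv.swap_apply_of_ne_of_ne (Ne.symm hie.2) (Ne.symm hje.2)]

end HamiltonianCycles

/-- **eigenvector of `A_U`, second kind.**  Let `n ≥ 6`,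
`U ⊂ {1, …, n}`, `|U| = m`, `3 ≤ m ≤ n/2`, and let `i, j ∈ U` be distinct.
The degree-1 polynomial
`u(x) = Σ_{l∈U, l≠i,j} ((n-m)/(m-2))(x_{il} - x_{jl}) + Σ_{t∉U} (-x_{it} + x_{jt})`
satisfies, for every degree-≤1 polynomial `w(x) = w₀ + Σ_e w_e x_e`,
`(1/|X|) Σ_{x∈X} h_U(x) u(x) w(x) = (2(m-2)/((n-3)(m-1))) ⟨u, w⟩`;
i.e. `u` is an eigenvector of the matrix of `q_{h_U}` with eigenvalue
`2(m-2)/((n-3)(m-1))`. -/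
theorem eigenvector_of_subtour_form_star
    (n m : ℕ) (hn : 6 ≤ n) (U : Finset (Fin n)) (hUcard : U.card = m)
    (hm3 : 3 ≤ m) (hmn : 2 * m ≤ n)
    (i j : Fin n) (hiU : i ∈ U) (hjU : j ∈ U) (hij : i ≠ j)
    (w0 : ℝ) (w : EdgeIdx n → ℝ) :
    ((hamX n).card : ℝ)⁻¹ * ∑ x ∈ hamX n,
        hU U x * (∑ e : EdgeIdx n, starCoef U m i j e * x e) *
          (w0 + ∑ e : EdgeIdx n, w e * x e)
      = (2 * ((m : ℝ) - 2) / (((n : ℝ) - 3) * ((m : ℝ) - 1))) *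
          ∑ e : EdgeIdx n, starCoef U m i j e * w e := by
  subst hUcard
  have hn' : (6 : ℝ) ≤ n := by exact_mod_cast hn
  have hm' : (3 : ℝ) ≤ U.card := by exact_mod_cast hm3
  have hmn' : 2 * (U.card : ℝ) ≤ n := by exact_mod_cast hmn
  have e1 : (n : ℝ) - 1 ≠ 0 := by linarith
  have e2 : (n : ℝ) - 2 ≠ 0 := by linarith
  have e3 : (n : ℝ) - 3 ≠ 0 := by linarith
  have em : (U.card : ℝ) - 2 ≠ 0 := by linarith
  have em1 : (U.card : ℝ) - 1 ≠ 0 := by linarith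
  have enm : (n : ℝ) - U.card - 1 ≠ 0 := by linarith
  have hc : (U.card : ℝ) * ((n : ℝ) - U.card) + 1 - n =
      ((U.card : ℝ) - 1) * ((n : ℝ) - U.card - 1) := by ring
  have hzero : cycleAvg (fun x => cutDiff U i j x * w0) = 0 :=
    cycleAvg_cutDiff_mul_eq_zero hiU hjU fun _ => rfl
  have hfactor : cycleAvg (fun x => hU U x * (∑ e : EdgeIdx n, starCoef U U.card i j e * x e) *
        (w0 + ∑ e : EdgeIdx n, w e * x e)) =
      -(((n : ℝ) - 1) / (2 * (((U.card : ℝ) - 1) * ((n : ℝ) - U.card - 1))) *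
        (((n : ℝ) - 2) / ((U.card : ℝ) - 2))) *
        (cycleAvg (fun x => cutDiff U i j x * w0) +
          ∑ e : EdgeIdx n, w e * cycleAvg (fun x => cutDiff U i j x * x e)) := by
    simp only [← cycleAvg_const_mul]
    rw [← cycleAvg_sum, ← cycleAvg_add, ← cycleAvg_const_mul]
    refine cycleAvg_congr fun x hx => ?_
    rw [sum_starCoef_mul (by omega) hm3 hiU hjU hij hx, hU, hc]
    simp only [mul_left_comm (w _), ← Finset.mul_sum, cutDiff, cutSize, cutDeg]
    ring
  change cycleAvg _ = _
  rw [hfactor, hzero, zero_add, Finset.mul_sum, Finset.mul_sum]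
  refine Finset.sum_congr rfl fun e _ => ?_
  rw [cycleAvg_cutDiff_mul_edge hn hm3 hmn hiU hjU hij]
  field_simp
  ring
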